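/- Fix ε ∈ (0,1). If 0 < τ₁ < τ₂ and P₁, P₂ > 0 satisfy P₁·τ₁·(1 − exp(−1/(P₁·τ₁))) = ε and P₂·τ₂·(1 − exp(−1/(P₂·τ₂))) = ε, then P₁ > P₂. -/

import Mathlib

/-- The function `x ↦ x * (1 - exp (-1 / x))` is strictly increasing on `(0, ∞)`: at `x` it is the
slope of the secant of `exp` between `-1 / x` and `0`. -/
lemma strictMonoOn_mul_one_sub_exp_neg_one_div :
    StrictMonoOn (fun x : ℝ => x * (1 - Real.exp (-1 / x))) (Set.Ioi 0) := by
  have secant_eq (z : ℝ) (hz : 0 < z) :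
      (Real.exp (-1 / z) - Real.exp 0) / (-1 / z - 0) = z * (1 - Real.exp (-1 / z)) := by
    rw [Real.exp_zero, sub_zero, div_div_eq_mul_div, div_neg, div_one]
    ring
  intro x (hx : 0 < x) y (hy : 0 < y) hxy
  have hlt : -1 / x < -1 / y := by
    rw [neg_div, neg_div]
    exact neg_lt_neg (one_div_lt_one_div_of_lt hx hxy)
  have hsecant := strictConvexOn_exp.secant_strict_mono (Set.mem_univ 0) (Set.mem_univ _)
    (Set.mem_univ _) (div_neg_of_neg_of_pos (by norm_num) hx).ne
    (div_neg_of_neg_of_pos (by norm_num) hy).ne hlt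
  rwa [secant_eq x hx, secant_eq y hy] at hsecant

/-- Fix `ε ∈ (0,1)`. If `0 < τ₁ < τ₂` and `P₁, P₂ > 0` satisfy the covertness equalities
`Pᵢ·τᵢ·(1 − exp(−1/(Pᵢ·τᵢ))) = ε`, then `P₁ > P₂`. -/
theorem covert_power_antitone_in_tau (ε τ₁ τ₂ P₁ P₂ : ℝ)
    (hε : ε ∈ Set.Ioo (0 : ℝ) 1)
    (hτ₁ : 0 < τ₁) (hτ : τ₁ < τ₂)
    (hP₁ : 0 < P₁) (hP₂ : 0 < P₂)
    (h₁ : P₁ * τ₁ * (1 - Real.exp (-1 / (P₁ * τ₁))) = ε)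
    (h₂ : P₂ * τ₂ * (1 - Real.exp (-1 / (P₂ * τ₂))) = ε) :
    P₁ > P₂ := by
  have heq : P₁ * τ₁ = P₂ * τ₂ :=
    strictMonoOn_mul_one_sub_exp_neg_one_div.injOn (mul_pos hP₁ hτ₁)
      (mul_pos hP₂ (hτ₁.trans hτ)) (h₁.trans h₂.symm)
  refine lt_of_mul_lt_mul_right ?_ hτ₁.le
  rw [heq]
  exact mul_lt_mul_of_pos_left hτ hP₂
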